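/- Let d ≥ 3 and suppose c', c_0, c_1, c_2 are positive constants for which the conclusion of Proposition 2.1 holds, namely: for every integer L_0 ≥ c', every n ≥ 0 and all 0 < u' ≤ (1 + c_0/ℓ_n^{d−2})^{−1}·u, one has q_{n+1}(u') ≤ c_1·ℓ_n²·(q_n(u)² + u'·L_n^{−2} + exp(−c_2(u − u')·L_n^{d−2})). Then there exists a constant c > 0 (depending only on d and these constants) such that whenever L_0 ≥ c is an integer, 0 < u_0 ≤ 1, and u_{n+1} = (1 + 1/log L_n)^{−1}·u_n, the following induction holds: if for some n ≥ 0 one has (i) c_2(u_n − u_{n+1})·L_n^{d−2} ≥ 2·log L_n and (ii) c_1·ℓ_n²·q_n(u_n) ≤ L_n^{−1}, then (i) and (ii) also hold with n + 1 in place of n. -/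

import Mathlib

open MeasureTheory Filter

namespace RI

/-- Points of `ℤ^d`. -/
abbrev Zd (d : ℕ) := Fin d → ℤ

/-- `x` and `y` are nearest neighbours: `|x - y| = 1`. -/
def adj {d : ℕ} (x y : Zd d) : Prop := (∑ i, |x i - y i|) = 1

/-- `x` and `y` are `*`-neighbours: `|x - y|_∞ = 1`. -/
def starAdj {d : ℕ} (x y : Zd d) : Prop := x ≠ y ∧ ∀ i, |x i - y i| ≤ 1

/-- `x` belongs to the plane `ℤ e₁ + ℤ e₂ ⊆ ℤ^d`. -/
def inPlane {d : ℕ} (x : Zd d) : Prop := ∀ i : Fin d, 2 ≤ (i : ℕ) → x i = 0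

/-- The `k`-th coordinate of `x`, with value `0` for out-of-range indices. -/
def coord {d : ℕ} (x : Zd d) (k : ℕ) : ℤ := if h : k < d then x ⟨k, h⟩ else 0

/-- `P` is the family of laws of the simple random walks on `ℤ^d` started at the points of
`ℤ^d`: each `P x` is a probability measure on the path space `ℕ → ℤ^d`, and the cylinder
probabilities are those of the walk with i.i.d. increments uniform on `{± e_i}`. -/
def IsSRW (d : ℕ) (P : Zd d → Measure (ℕ → Zd d)) : Prop :=
  (∀ x, IsProbabilityMeasure (P x)) ∧
  (∀ (x : Zd d) (n : ℕ) (w : ℕ → Zd d),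
      (w 0 = x ∧ ∀ k < n, adj (w k) (w (k + 1))) →
        P x {ω | ∀ k ≤ n, ω k = w k} = ((2 * d : ENNReal))⁻¹ ^ n) ∧
  (∀ (x : Zd d) (n : ℕ) (w : ℕ → Zd d),
      ¬(w 0 = x ∧ ∀ k < n, adj (w k) (w (k + 1))) →
        P x {ω | ∀ k ≤ n, ω k = w k} = 0)

/-- The equilibrium measure of a set `V ⊆ ℤ^d`:
`e_V(x) = P_x[H̃_V = ∞]` for `x ∈ V`, and `0` otherwise. -/
noncomputable def eqm {d : ℕ} (P : Zd d → Measure (ℕ → Zd d)) (V : Set (Zd d)) : Zd d → ℝ :=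
  V.indicator fun x => (P x {ω | ∀ n, 1 ≤ n → ω n ∉ V}).toReal

/-- The capacity of a finite set `K ⊆ ℤ^d`. -/
noncomputable def capa {d : ℕ} (P : Zd d → Measure (ℕ → Zd d)) (K : Finset (Zd d)) : ℝ :=
  ∑ x ∈ K, eqm P (↑K) x

/-- `Q` is a vacant-set law at level `u`: a probability measure on `{0,1}^{ℤ^d}`
(with `true = 1` standing for "vacant") such that
`Q[Y_x = 1 ∀ x ∈ K] = exp(-u cap K)` for every finite `K`. -/
def IsVacantLaw {d : ℕ} (P : Zd d → Measure (ℕ → Zd d)) (u : ℝ)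
    (Q : Measure (Zd d → Bool)) : Prop :=
  IsProbabilityMeasure Q ∧
  ∀ K : Finset (Zd d),
    Q {Y | ∀ x ∈ K, Y x = true} = ENNReal.ofReal (Real.exp (-(u * capa P K)))

/-- There is a `*`-path starting in `S`, ending in `T`, all of whose points lie in `A`. -/
def HasStarPath {d : ℕ} (S T A : Set (Zd d)) : Prop :=
  ∃ (N : ℕ) (w : ℕ → Zd d), w 0 ∈ S ∧ w N ∈ T ∧ (∀ k ≤ N, w k ∈ A) ∧
    ∀ k < N, starAdj (w k) (w (k + 1))

/-- Interior boundary `∂_int U`. -/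
def intBdry {d : ℕ} (U : Set (Zd d)) : Set (Zd d) := {x | x ∈ U ∧ ∃ y, y ∉ U ∧ adj x y}

/-- (Exterior) boundary `∂U`. -/
def bdry {d : ℕ} (U : Set (Zd d)) : Set (Zd d) := {x | x ∉ U ∧ ∃ y ∈ U, adj x y}

/-- `ℓ = 100 ⌊L^{1/100}⌋ + 1`. -/
noncomputable def ellOf (L : ℕ) : ℕ := 100 * ⌊(L : ℝ) ^ ((1 : ℝ) / 100)⌋₊ + 1

/-- The scales `L_{n+1} = ℓ_n L_n`. -/
noncomputable def Lseq (L0 : ℕ) : ℕ → ℕ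
  | 0 => L0
  | n + 1 => ellOf (Lseq L0 n) * Lseq L0 n

/-- The levels `u_{n+1} = (1 + 1/log L_n)⁻¹ u_n`. -/
noncomputable def useq (L0 : ℕ) (u0 : ℝ) : ℕ → ℝ
  | 0 => u0
  | n + 1 => (1 + 1 / Real.log (Lseq L0 n))⁻¹ * useq L0 u0 n

/-- The event (on the configuration space `{0,1}^{ℤ^d}`) that there is a `*`-path from
`[-L,L]² ∩ ℤ²` to `∂_int ([-3L,3L]^d ∩ ℤ^d)` all of whose points lie in `{x ∈ ℤ² : Y_x = 0}`. -/
def qEvent (d : ℕ) (L : ℕ) : Set (Zd d → Bool) :=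
  {Y | HasStarPath
    {x : Zd d | inPlane x ∧ ∀ i, |x i| ≤ (L : ℤ)}
    (intBdry {x : Zd d | ∀ i, |x i| ≤ (3 * L : ℤ)})
    {x : Zd d | inPlane x ∧ Y x = false}}


end RI

open RI MeasureTheory Filter

namespace RI

theorem one_le_rpow_hundredth {L : ℕ} (hL : 1 ≤ L) : 1 ≤ (L : ℝ) ^ ((1 : ℝ) / 100) :=
  Real.one_le_rpow (by exact_mod_cast hL) (by norm_num)

theorem one_le_ellOf (L : ℕ) : 1 ≤ ellOf L := by
  unfold ellOf
  omega

theorem hundred_le_ellOf {L : ℕ} (hL : 1 ≤ L) : 100 ≤ ellOf L := by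
  have h : 1 ≤ ⌊(L : ℝ) ^ ((1 : ℝ) / 100)⌋₊ :=
    Nat.le_floor (by exact_mod_cast one_le_rpow_hundredth hL)
  unfold ellOf
  omega

theorem rpow_le_ellOf (L : ℕ) : (L : ℝ) ^ ((1 : ℝ) / 100) ≤ ellOf L := by
  have h := (Nat.lt_floor_add_one ((L : ℝ) ^ ((1 : ℝ) / 100))).le
  have h0 : (0 : ℝ) ≤ ⌊(L : ℝ) ^ ((1 : ℝ) / 100)⌋₊ := Nat.cast_nonneg _
  unfold ellOf
  push_cast
  linarith

theorem ellOf_le {L : ℕ} (hL : 1 ≤ L) : (ellOf L : ℝ) ≤ 101 * (L : ℝ) ^ ((1 : ℝ) / 100) := by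
  have h1 := one_le_rpow_hundredth hL
  have h := Nat.floor_le (zero_le_one.trans h1)
  unfold ellOf
  push_cast
  linarith

theorem le_Lseq (L0 n : ℕ) : L0 ≤ Lseq L0 n := by
  induction n with
  | zero => exact le_rfl
  | succ n ih => exact ih.trans (Nat.le_mul_of_pos_left _ (one_le_ellOf _))

/-- The next scale is at most the cube of the current one. -/
theorem ellOf_mul_le_pow_three {L : ℕ} (hL : 101 ≤ L) :
    ((ellOf L * L : ℕ) : ℝ) ≤ (L : ℝ) ^ 3 := by
  have hL1 : (101 : ℝ) ≤ L := by exact_mod_cast hL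
  have h1 := ellOf_le (L := L) (by omega)
  have h2 : (L : ℝ) ^ ((1 : ℝ) / 100) ≤ L := by
    conv_rhs => rw [← Real.rpow_one (L : ℝ)]
    exact Real.rpow_le_rpow_of_exponent_le (by linarith) (by norm_num)
  push_cast
  have : (ellOf L : ℝ) ≤ L * L := by nlinarith
  nlinarith

theorem ellOf_ellOf_mul_le {L : ℕ} (hL : 101 ≤ L) :
    (ellOf (ellOf L * L) : ℝ) ≤ 101 * ((L : ℝ) ^ ((1 : ℝ) / 100)) ^ 3 := by
  have hpos : 1 ≤ ellOf L * L :=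
    Nat.one_le_iff_ne_zero.2 (Nat.mul_ne_zero (by have := one_le_ellOf L; omega) (by omega))
  refine (ellOf_le hpos).trans ?_
  have h := Real.rpow_le_rpow (Nat.cast_nonneg _) (ellOf_mul_le_pow_three hL)
    (by norm_num : (0 : ℝ) ≤ 1 / 100)
  have e : ((L : ℝ) ^ 3) ^ ((1 : ℝ) / 100) = ((L : ℝ) ^ ((1 : ℝ) / 100)) ^ 3 := by
    rw [← Real.rpow_natCast, ← Real.rpow_natCast, ← Real.rpow_mul (Nat.cast_nonneg _),
      ← Real.rpow_mul (Nat.cast_nonneg _), mul_comm]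
  rw [e] at h
  linarith

/-- Powers of the scale factors are negligible with respect to large scales. -/
theorem eventually_ellOf_pow_mul_le (K : ℝ) (hK : 0 ≤ K) : ∀ᶠ x : ℝ in atTop,
    ∀ L : ℕ, x ≤ L → K * (ellOf L : ℝ) ^ 3 * (ellOf (ellOf L * L) : ℝ) ^ 2 ≤ L := by
  have ht := (tendsto_rpow_atTop (by norm_num : (0 : ℝ) < 91 / 100)).eventually_ge_atTop
    (K * 101 ^ 5)
  obtain ⟨b, hb⟩ := eventually_atTop.1 ht
  filter_upwards [eventually_ge_atTop b, eventually_ge_atTop 101] with x hx hx' L hL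
  have hL1 : (101 : ℝ) ≤ L := hx'.trans hL
  have hL2 : 101 ≤ L := by exact_mod_cast hL1
  have h0 : (0 : ℝ) < L := by linarith
  have h1 := ellOf_le (L := L) (by omega)
  have h2 := ellOf_ellOf_mul_le hL2
  have h3 := hb L (hx.trans hL)
  set y := (L : ℝ) ^ ((1 : ℝ) / 100) with hy
  have hy0 : 0 ≤ y := Real.rpow_nonneg h0.le _
  have e : (L : ℝ) ^ ((91 : ℝ) / 100) * y ^ 9 = L := by
    rw [hy, ← Real.rpow_natCast, ← Real.rpow_mul h0.le, ← Real.rpow_add h0]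
    norm_num
  calc K * (ellOf L : ℝ) ^ 3 * (ellOf (ellOf L * L) : ℝ) ^ 2
      ≤ K * (101 * y) ^ 3 * (101 * y ^ 3) ^ 2 := by gcongr
    _ = K * 101 ^ 5 * y ^ 9 := by ring
    _ ≤ (L : ℝ) ^ ((91 : ℝ) / 100) * y ^ 9 := by gcongr
    _ = L := e

theorem eventually_mul_log_le_ellOf (K : ℝ) : ∀ᶠ x : ℝ in atTop,
    ∀ L : ℕ, x ≤ L → K * Real.log L ≤ ellOf L := by
  have h := ((isLittleO_log_rpow_atTop (by norm_num : (0 : ℝ) < 1 / 100)).const_mul_left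
    K).eventuallyLE
  obtain ⟨b, hb⟩ := eventually_atTop.1 h
  filter_upwards [eventually_ge_atTop b] with x hx L hL
  have h1 := hb L (hx.trans hL)
  rw [Real.norm_of_nonneg (Real.rpow_nonneg (Nat.cast_nonneg L) _)] at h1
  exact (le_abs_self _).trans (h1.trans (rpow_le_ellOf L))

theorem useq_pos (L0 : ℕ) {u0 : ℝ} (hu : 0 < u0) (n : ℕ) : 0 < useq L0 u0 n := by
  induction n with
  | zero => exact hu
  | succ n ih =>
    have : 0 ≤ Real.log (Lseq L0 n) := Real.log_natCast_nonneg _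
    rw [useq]
    positivity

theorem useq_le_one (L0 : ℕ) {u0 : ℝ} (hu : 0 < u0) (hu1 : u0 ≤ 1) (n : ℕ) :
    useq L0 u0 n ≤ 1 := by
  induction n with
  | zero => exact hu1
  | succ n ih =>
    have : 0 ≤ Real.log (Lseq L0 n) := Real.log_natCast_nonneg _
    rw [useq]
    refine mul_le_one₀ (inv_le_one_of_one_le₀ ?_) (useq_pos L0 hu n).le ih
    have : 0 ≤ 1 / Real.log (Lseq L0 n) := by positivity
    linarith

end RI

/-- **Propagation of the induction hypotheses** (Proposition 2.4).
Assume that the conclusion of Proposition 2.1 holds with positive constants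
`c', c₀, c₁, c₂`. Then there is a constant `c > 0` such that for every integer `L₀ ≥ c`,
every `0 < u₀ ≤ 1`, with `u_{n+1} = (1 + 1/log L_n)⁻¹ u_n`: if for some `n`
(i) `c₂ (u_n - u_{n+1}) L_n^{d-2} ≥ 2 log L_n` and (ii) `c₁ ℓ_n² q_n(u_n) ≤ L_n⁻¹`,
then (i) and (ii) hold with `n + 1` in place of `n`. -/
theorem induction_propagates (d : ℕ) (hd : 3 ≤ d)
    (c' c0 c1 c2 : ℝ) (hc' : 0 < c') (hc0 : 0 < c0) (hc1 : 0 < c1) (hc2 : 0 < c2)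
    (H : ∀ L0 : ℕ, c' ≤ (L0 : ℝ) → ∀ n : ℕ, ∀ u u' : ℝ, 0 < u' →
      u' ≤ (1 + c0 / (ellOf (Lseq L0 n) : ℝ) ^ (d - 2))⁻¹ * u →
      ∀ (P : Zd d → Measure (ℕ → Zd d)), IsSRW d P →
        ∀ Q Q' : Measure (Zd d → Bool),
          IsVacantLaw P u Q → IsVacantLaw P u' Q' →
          (Q' (qEvent d (Lseq L0 (n + 1)))).toReal ≤
            c1 * (ellOf (Lseq L0 n) : ℝ) ^ 2 *
              ((Q (qEvent d (Lseq L0 n))).toReal ^ 2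
                + u' * ((Lseq L0 n : ℝ) ^ 2)⁻¹
                + Real.exp (-(c2 * (u - u') * (Lseq L0 n : ℝ) ^ (d - 2))))) :
    ∃ c : ℝ, 0 < c ∧
      ∀ L0 : ℕ, c ≤ (L0 : ℝ) → ∀ u0 : ℝ, 0 < u0 → u0 ≤ 1 →
        ∀ (P : Zd d → Measure (ℕ → Zd d)), IsSRW d P →
          ∀ Q : ℕ → Measure (Zd d → Bool),
            (∀ n : ℕ, IsVacantLaw P (useq L0 u0 n) (Q n)) →
            ∀ n : ℕ,
              (2 * Real.log (Lseq L0 n) ≤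
                  c2 * (useq L0 u0 n - useq L0 u0 (n + 1)) * (Lseq L0 n : ℝ) ^ (d - 2) ∧
                c1 * (ellOf (Lseq L0 n) : ℝ) ^ 2 * (Q n (qEvent d (Lseq L0 n))).toReal
                  ≤ (Lseq L0 n : ℝ)⁻¹) →
              (2 * Real.log (Lseq L0 (n + 1)) ≤
                  c2 * (useq L0 u0 (n + 1) - useq L0 u0 (n + 2)) *
                    (Lseq L0 (n + 1) : ℝ) ^ (d - 2) ∧
                c1 * (ellOf (Lseq L0 (n + 1)) : ℝ) ^ 2 *
                    (Q (n + 1) (qEvent d (Lseq L0 (n + 1)))).toReal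
                  ≤ (Lseq L0 (n + 1) : ℝ)⁻¹) := by
  obtain ⟨b, hb⟩ := eventually_atTop.1
    ((eventually_ellOf_pow_mul_le (1 + 2 * c1 ^ 2) (by positivity)).and
      (eventually_mul_log_le_ellOf c0))
  refine ⟨max (max b c') 101, by positivity, ?_⟩
  intro L0 hL0 u0 hu0 hu1 P hP Q hQ n ⟨hi, hii⟩
  have hL0c : c' ≤ L0 := (le_max_right _ _).trans ((le_max_left _ _).trans hL0)
  have hL0b : b ≤ L0 := (le_max_left _ _).trans ((le_max_left _ _).trans hL0)
  have hL0n : 101 ≤ L0 := by exact_mod_cast (le_max_right _ _).trans hL0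
  have hHn := H L0 hL0c n (useq L0 u0 n) (useq L0 u0 (n + 1))
    (useq_pos L0 hu0 _)
  have hun := useq_le_one L0 hu0 hu1 (n + 1)
  have hup0 := useq_pos L0 hu0 n
  have hle : L0 ≤ Lseq L0 n := le_Lseq L0 n
  have hL1 : Lseq L0 (n + 1) = ellOf (Lseq L0 n) * Lseq L0 n := rfl
  have huu : useq L0 u0 (n + 1) = (1 + 1 / Real.log (Lseq L0 n))⁻¹ * useq L0 u0 n := rfl
  have huu2 : useq L0 u0 (n + 2) =
    (1 + 1 / Real.log (Lseq L0 (n + 1)))⁻¹ * useq L0 u0 (n + 1) := rfl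
  have hHn := fun h => hHn h P hP (Q n) (Q (n + 1)) (hQ n) (hQ (n + 1))
  rw [hL1] at hHn huu2 ⊢
  have hbL : b ≤ Lseq L0 n := hL0b.trans (by exact_mod_cast hle)
  obtain ⟨hA, hB⟩ := hb b le_rfl
  replace hA := hA _ hbL
  replace hB := hB _ hbL
  have hp : 0 ≤ (Q n (qEvent d (Lseq L0 n))).toReal := ENNReal.toReal_nonneg
  generalize (Q n (qEvent d (Lseq L0 n))).toReal = q at *
  generalize useq L0 u0 (n + 2) = u2 at *
  generalize useq L0 u0 (n + 1) = u1 at *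
  generalize useq L0 u0 n = u at *
  generalize Lseq L0 n = L at *
  have hLL : 101 ≤ L := hL0n.trans hle
  have hLR : (101 : ℝ) ≤ L := by exact_mod_cast hLL
  have hl100 : (100 : ℝ) ≤ ellOf L := by exact_mod_cast hundred_le_ellOf (by omega : 1 ≤ L)
  have hM := ellOf_mul_le_pow_three hLL
  have hlogL : 1 ≤ Real.log L := by
    rw [Real.le_log_iff_exp_le (by linarith)]
    linarith [Real.exp_one_lt_d9]
  have hlogM : Real.log ((ellOf L * L : ℕ) : ℝ) ≤ 3 * Real.log L := by
    have := Real.log_le_log (by push_cast; positivity) hM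
    rwa [Real.log_pow] at this
  have hlogM1 : Real.log L ≤ Real.log ((ellOf L * L : ℕ) : ℝ) := by
    refine Real.log_le_log (by linarith) ?_
    push_cast
    nlinarith
  have hpow : (ellOf L : ℝ) ≤ (ellOf L : ℝ) ^ (d - 2) :=
    le_self_pow₀ (by linarith) (by omega)
  generalize Real.log ((ellOf L * L : ℕ) : ℝ) = B at *
  have hq := hHn ?_
  · constructor
    · have e1 : (u - u1) * Real.log L = u1 := by
        rw [huu]; field_simp; ring
      have e2 : (u1 - u2) * (1 + B) = u1 := by
        have : 0 < B := by linarith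
        rw [huu2]; field_simp; ring
      have h1 : 2 * Real.log L ^ 2 ≤ c2 * u1 * (L : ℝ) ^ (d - 2) := by
        calc 2 * Real.log L ^ 2 = 2 * Real.log L * Real.log L := by ring
          _ ≤ c2 * (u - u1) * (L : ℝ) ^ (d - 2) * Real.log L := by gcongr
          _ = c2 * ((u - u1) * Real.log L) * (L : ℝ) ^ (d - 2) := by ring
          _ = c2 * u1 * (L : ℝ) ^ (d - 2) := by rw [e1]
      refine le_of_mul_le_mul_right ?_ (by linarith : 0 < 1 + B)
      push_cast
      rw [mul_pow]
      calc 2 * B * (1 + B) ≤ 100 * (2 * Real.log L ^ 2) := by nlinarith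
        _ ≤ (ellOf L : ℝ) ^ (d - 2) * (c2 * u1 * (L : ℝ) ^ (d - 2)) := by
          gcongr
          linarith
        _ = (ellOf L : ℝ) ^ (d - 2) * (c2 * ((u1 - u2) * (1 + B)) * (L : ℝ) ^ (d - 2)) := by
          rw [e2]
        _ = _ := by ring
    · have hL0 : (0 : ℝ) < L := by linarith
      have hexp : Real.exp (-(c2 * (u - u1) * (L : ℝ) ^ (d - 2))) ≤ ((L : ℝ) ^ 2)⁻¹ := by
        calc _ ≤ Real.exp (-(2 * Real.log L)) := by gcongr
          _ = ((L : ℝ) ^ 2)⁻¹ := by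
            rw [Real.exp_neg, two_mul, Real.exp_add, Real.exp_log hL0, pow_two]
      have hq1 : c1 * q ≤ (L : ℝ)⁻¹ := by
        have : 0 ≤ c1 * q := by positivity
        have h1 : 1 ≤ (ellOf L : ℝ) ^ 2 := one_le_pow₀ (by linarith)
        nlinarith
      have hq2 : c1 ^ 2 * q ^ 2 ≤ ((L : ℝ) ^ 2)⁻¹ := by
        calc c1 ^ 2 * q ^ 2 = (c1 * q) ^ 2 := by ring
          _ ≤ ((L : ℝ)⁻¹) ^ 2 := by gcongr
          _ = _ := by rw [inv_pow]
      have hl0 : (0 : ℝ) < ellOf L := by linarith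
      set l : ℝ := (ellOf L : ℝ) with hl
      set m : ℝ := (ellOf (ellOf L * L) : ℝ)
      calc c1 * m ^ 2 * (Q (n + 1) (qEvent d (ellOf L * L))).toReal
          ≤ c1 * m ^ 2 * (c1 * l ^ 2 * (q ^ 2 + 1 * ((L : ℝ) ^ 2)⁻¹ + ((L : ℝ) ^ 2)⁻¹)) := by
            gcongr
            refine hq.trans ?_
            gcongr
        _ = m ^ 2 * l ^ 2 * (c1 ^ 2 * q ^ 2 + 2 * c1 ^ 2 * ((L : ℝ) ^ 2)⁻¹) := by ring
        _ ≤ m ^ 2 * l ^ 2 * (((L : ℝ) ^ 2)⁻¹ + 2 * c1 ^ 2 * ((L : ℝ) ^ 2)⁻¹) := by gcongr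
        _ = ((1 + 2 * c1 ^ 2) * l ^ 3 * m ^ 2) * (l * (L : ℝ) ^ 2)⁻¹ := by
            field_simp
        _ ≤ L * (l * (L : ℝ) ^ 2)⁻¹ := by gcongr
        _ = ((ellOf L * L : ℕ) : ℝ)⁻¹ := by
            rw [Nat.cast_mul, ← hl]
            field_simp
  · rw [huu]
    have : 0 < Real.log L := by linarith
    gcongr ?_ * _
    refine inv_anti₀ (by positivity) ?_
    gcongr 1 + ?_
    rw [div_le_div_iff₀ (by positivity) this]
    linarith
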